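/- For every n ≥ 0, the number of permutations π of {1,2,…,n+1} such that both π and rc(π) avoid the patterns 1243 and 2143 equals the number of Schröder paths of length n belonging to D_n. -/

import Mathlib

/-- A step of a lattice path: `E = (1,0)`, `N = (0,1)`, `D = (1,1)`. -/
inductive Step : Type
  | E : Step
  | N : Step
  | D : Step
  deriving DecidableEq

/-- The x-coordinate of the lattice point reached after performing the steps `q`
(starting from the origin). -/
def posX (q : List Step) : ℕ := q.count Step.E + q.count Step.D

/-- The y-coordinate of the lattice point reached after performing the steps `q`
(starting from the origin). -/
def posY (q : List Step) : ℕ := q.count Step.N + q.count Step.D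

/-- A Schröder prefix: a lattice path starting at the origin which never passes
below the line `y = x`. -/
def IsSchroderPrefix (p : List Step) : Prop :=
  ∀ q : List Step, q <+: p → posX q ≤ posY q

/-- A Schröder path of length `n`: a Schröder prefix terminating at `(n, n)`. -/
def IsSchroderPath (n : ℕ) (p : List Step) : Prop :=
  IsSchroderPrefix p ∧ posX p = n ∧ posY p = n

/-- Interchange `E` and `N` steps. -/
def revStep : Step → Step
  | Step.E => Step.N
  | Step.N => Step.E
  | Step.D => Step.D

/-- The reversal of a Schröder path: write the steps in reverse order and
interchange `E` and `N` steps. -/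
def revPath (p : List Step) : List Step := p.reverse.map revStep

/-- Words which are concatenations of blocks, each block being a single `D` step or
of the form `N^k E^k` for some `k > 0`. -/
inductive IsInnerWord : List Step → Prop
  | nil : IsInnerWord []
  | dcons {p : List Step} : IsInnerWord p → IsInnerWord (Step.D :: p)
  | peak {k : ℕ} {p : List Step} : 0 < k → IsInnerWord p →
      IsInnerWord (List.replicate k Step.N ++ List.replicate k Step.E ++ p)

/-- Words which are concatenations of blocks, each block being a single `D` step or of
the form `N q E` where `q` is an inner word. -/
inductive IsDWord : List Step → Prop
  | nil : IsDWord []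
  | dcons {p : List Step} : IsDWord p → IsDWord (Step.D :: p)
  | block {q p : List Step} : IsInnerWord q → IsDWord p →
      IsDWord (Step.N :: (q ++ Step.E :: p))

/-- Membership in `𝒟_n`: a Schröder path of length `n` of the prescribed block form. -/
def MemD (n : ℕ) (p : List Step) : Prop := IsDWord p ∧ IsSchroderPath n p

/-- Membership in `𝒟`: Schröder prefixes occurring as initial segments of some
path in `𝒟_m` for some finite `m`. -/
def MemCalD (p : List Step) : Prop := ∃ (m : ℕ) (q : List Step), p <+: q ∧ MemD m q

/-- `p` has a level feature at `t`: a `D` step joining `(t-1, t)` to `(t, t+1)`. -/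
def HasLevelFeatureAt (p : List Step) (t : ℕ) : Prop :=
  1 ≤ t ∧ ∃ q r : List Step, p = q ++ Step.D :: r ∧ posX q = t - 1 ∧ posY q = t

/-- `p` has a notch feature at `t`: an `E` step joining `(t-1, t)` to `(t, t)`
immediately followed by an `N` step joining `(t, t)` to `(t, t+1)`. -/
def HasNotchFeatureAt (p : List Step) (t : ℕ) : Prop :=
  1 ≤ t ∧ ∃ q r : List Step, p = q ++ Step.E :: Step.N :: r ∧ posX q = t - 1 ∧ posY q = t

/-- `p` has no (level or notch) features. -/
def Featureless (p : List Step) : Prop :=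
  ∀ t : ℕ, ¬ HasLevelFeatureAt p t ∧ ¬ HasNotchFeatureAt p t

/-- Auxiliary function for `psi`, processing the path left to right while keeping track of
the current height `y - x` above the diagonal: at height `1`, a `D` step (a level feature)
is replaced by `E N` (a notch feature) and vice versa; all other steps are unchanged. -/
def psiAux : ℕ → List Step → List Step
  | 1, Step.D :: rest => Step.E :: Step.N :: psiAux 1 rest
  | 1, Step.E :: Step.N :: rest => Step.D :: psiAux 1 rest
  | h, Step.N :: rest => Step.N :: psiAux (h + 1) rest
  | h, Step.E :: rest => Step.E :: psiAux (h - 1) rest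
  | h, Step.D :: rest => Step.D :: psiAux h rest
  | _, [] => []
  termination_by h l => l.length

/-- `psi p` replaces every level feature of `p` by a notch feature at the same place and
vice versa, leaving all other steps unchanged. -/
def psi (p : List Step) : List Step := psiAux 0 p

/-- `a i`: the number of Schröder prefixes in `𝒟` terminating at `(i, i)`. -/
noncomputable def aSeq (i : ℕ) : ℕ :=
  Set.ncard {p : List Step | MemCalD p ∧ posX p = i ∧ posY p = i}

/-- `b i`: the number of Schröder prefixes in `𝒟` terminating at `(i-1, i)` (and `b 0 = 0`). -/
noncomputable def bSeq (i : ℕ) : ℕ :=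
  Set.ncard {p : List Step | MemCalD p ∧ posX p + 1 = i ∧ posY p = i}

/-- `c i`: the number of featureless Schröder prefixes in `𝒟` terminating at `(i, i)`. -/
noncomputable def cSeq (i : ℕ) : ℕ :=
  Set.ncard {p : List Step | MemCalD p ∧ Featureless p ∧ posX p = i ∧ posY p = i}

/-- `d i`: the number of featureless Schröder prefixes in `𝒟` terminating at `(i-1, i)`
(and `d 0 = 0`). -/
noncomputable def dSeq (i : ℕ) : ℕ :=
  Set.ncard {p : List Step | MemCalD p ∧ Featureless p ∧ posX p + 1 = i ∧ posY p = i}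

/-- The permutation `π` (of `{1, …, n}`, 0-indexed as `Fin n`) contains the pattern `τ`
(a permutation of `{1, …, k}`, 0-indexed as `Fin k`). -/
def Contains {n k : ℕ} (π : Equiv.Perm (Fin n)) (τ : Equiv.Perm (Fin k)) : Prop :=
  ∃ f : Fin k → Fin n, StrictMono f ∧ ∀ a b : Fin k, τ a < τ b ↔ π (f a) < π (f b)

/-- The permutation `π` avoids the pattern `τ`. -/
def Avoids {n k : ℕ} (π : Equiv.Perm (Fin n)) (τ : Equiv.Perm (Fin k)) : Prop :=
  ¬ Contains π τ

/-- The reverse-complement of a permutation: `rc π (i) = (n+1) - π (n+1-i)` (1-indexed),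
i.e. `rc π (i) = rev (π (rev i))` in 0-indexed form. -/
def rc {n : ℕ} (π : Equiv.Perm (Fin n)) : Equiv.Perm (Fin n) :=
  (Fin.revPerm.trans π).trans Fin.revPerm

/-- The pattern `1243` (0-indexed: `0 ↦ 0, 1 ↦ 1, 2 ↦ 3, 3 ↦ 2`). -/
def pat1243 : Equiv.Perm (Fin 4) := Equiv.swap 2 3

/-- The pattern `2143` (0-indexed: `0 ↦ 1, 1 ↦ 0, 2 ↦ 3, 3 ↦ 2`). -/
def pat2143 : Equiv.Perm (Fin 4) := Equiv.swap 0 1 * Equiv.swap 2 3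

/-- The pattern `2134` (0-indexed: `0 ↦ 1, 1 ↦ 0, 2 ↦ 2, 3 ↦ 3`). -/
def pat2134 : Equiv.Perm (Fin 4) := Equiv.swap 0 1


def LA (l : List ℕ) : Prop :=
  ∀ a b c d, [a, b, c, d].Sublist l → a < c → a < d → b < c → b < d → a < b ∧ c < d

def LF (l : List ℕ) : Prop :=
  (∀ a b c, [a, b, c].Sublist l → ¬ (b < a ∧ a < c)) ∧
  (∀ a b c d, [a, b, c, d].Sublist l → ¬ (a < b ∧ b < d ∧ d < c))

def LI (l : List ℕ) : Prop := ∀ a b, [a, b].Sublist l → a < b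

def HX (X P : List ℕ → Prop) : Prop :=
  ∀ (L R : List ℕ) (n h : ℕ), (L ++ n :: R).Nodup → h ∈ L → (∀ x ∈ L, h ≤ x) →
    (∀ x ∈ L, x < n) → (∀ x ∈ R, x < n) →
    (X (L ++ n :: R) ↔ P L ∧ X (h :: R) ∧ ∀ x ∈ L, x ≠ h → ∀ r ∈ R, r < x)

def HX0 (X : List ℕ → Prop) : Prop :=
  ∀ (R : List ℕ) (n : ℕ), (∀ x ∈ R, x < n) → (X (n :: R) ↔ X R)

def HInv (P : List ℕ → Prop) : Prop :=
  ∀ (L : List ℕ) (g : ℕ → ℕ), StrictMono g → (P (L.map g) ↔ P L)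

theorem sub_pair {L : List ℕ} {x h : ℕ} (hx : x ∈ L) (hh : h ∈ L) (hne : x ≠ h) :
    [h, x].Sublist L ∨ [x, h].Sublist L := by
  obtain ⟨s, t, rfl⟩ := List.append_of_mem hx
  rcases List.mem_append.1 hh with h1 | h1
  · left
    exact List.Sublist.append (List.singleton_sublist.2 h1)
      (List.singleton_sublist.2 (by simp : x ∈ x :: t))
  · right
    have h2 : h ∈ t := by
      rcases List.mem_cons.1 h1 with h2 | h2
      · exact absurd h2.symm hne
      · exact h2
    exact ((List.singleton_sublist.2 h2).cons_cons x).trans (List.sublist_append_right s _)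

theorem split4 {L R : List ℕ} {n a b c d : ℕ} (h : [a, b, c, d].Sublist (L ++ n :: R)) :
    [a, b, c, d].Sublist L ∨ ([a, b, c].Sublist L ∧ (d = n ∨ d ∈ R)) ∨
    ([a, b].Sublist L ∧ ((c = n ∧ d ∈ R) ∨ [c, d].Sublist R)) ∨
    (a ∈ L ∧ (b = n ∧ [c, d].Sublist R ∨ [b, c, d].Sublist R)) ∨
    (a = n ∧ [b, c, d].Sublist R) ∨ [a, b, c, d].Sublist R := by
  obtain ⟨s, t, e, hs, ht⟩ := List.sublist_append_iff.1 h
  rcases s with _ | ⟨s1, _ | ⟨s2, _ | ⟨s3, _ | ⟨s4, s⟩⟩⟩⟩ <;> simp at e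
  · subst e
    rcases List.sublist_cons_iff.1 ht with h1 | ⟨r, h1, h2⟩
    · simp [h1]
    · simp at h1; obtain ⟨rfl, rfl⟩ := h1; simp [h2]
  · obtain ⟨rfl, rfl⟩ := e
    have := List.singleton_sublist.1 hs
    rcases List.sublist_cons_iff.1 ht with h1 | ⟨r, h1, h2⟩
    · simp [h1, this]
    · simp at h1; obtain ⟨rfl, rfl⟩ := h1; simp [h2, this]
  · obtain ⟨rfl, rfl, rfl⟩ := e
    rcases List.sublist_cons_iff.1 ht with h1 | ⟨r, h1, h2⟩
    · simp [h1, hs]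
    · simp at h1; obtain ⟨rfl, rfl⟩ := h1; simp at h2; simp [h2, hs]
  · obtain ⟨rfl, rfl, rfl, rfl⟩ := e
    have := List.singleton_sublist.1 ht
    simp at this
    simp [hs, this]
  · obtain ⟨rfl, rfl, rfl, rfl, rfl, rfl⟩ := e
    simp [hs]

theorem split3 {L R : List ℕ} {n b c d : ℕ} (h : [b, c, d].Sublist (L ++ n :: R)) :
    [b, c, d].Sublist L ∨
    ([b, c].Sublist L ∧ (d = n ∨ d ∈ R)) ∨
    (b ∈ L ∧ (c = n ∧ d ∈ R ∨ [c, d].Sublist R)) ∨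
    (b = n ∧ [c, d].Sublist R) ∨ [b, c, d].Sublist R := by
  obtain ⟨s, t, e, hs, ht⟩ := List.sublist_append_iff.1 h
  rcases s with _ | ⟨s1, _ | ⟨s2, _ | ⟨s3, s⟩⟩⟩ <;> simp at e
  · subst e
    rcases List.sublist_cons_iff.1 ht with h1 | ⟨r, h1, h2⟩
    · simp [h1]
    · simp at h1; obtain ⟨rfl, rfl⟩ := h1; simp [h2]
  · obtain ⟨rfl, rfl⟩ := e
    have := List.singleton_sublist.1 hs
    rcases List.sublist_cons_iff.1 ht with h1 | ⟨r, h1, h2⟩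
    · simp [h1, this]
    · simp at h1; obtain ⟨rfl, rfl⟩ := h1; simp at h2; simp [h2, this]
  · obtain ⟨rfl, rfl, rfl⟩ := e
    have := List.singleton_sublist.1 ht
    simp at this
    simp [hs, this]
  · obtain ⟨rfl, rfl, rfl, rfl, rfl⟩ := e
    simp [hs]

theorem mem2 {L : List ℕ} {a b : ℕ} (h : [a, b].Sublist L) : a ∈ L ∧ b ∈ L :=
  ⟨h.subset (by simp), h.subset (by simp)⟩

theorem mem3 {L : List ℕ} {a b c : ℕ} (h : [a, b, c].Sublist L) : a ∈ L ∧ b ∈ L ∧ c ∈ L :=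
  ⟨h.subset (by simp), h.subset (by simp), h.subset (by simp)⟩

theorem mem4 {L : List ℕ} {a b c d : ℕ} (h : [a, b, c, d].Sublist L) :
    a ∈ L ∧ b ∈ L ∧ c ∈ L ∧ d ∈ L :=
  ⟨h.subset (by simp), h.subset (by simp), h.subset (by simp), h.subset (by simp)⟩

theorem pre2 {a b c : ℕ} {L : List ℕ} (h : [a, b, c].Sublist L) : [a, b].Sublist L :=
  List.Sublist.trans (by simp) h

theorem pre3 {a b c d : ℕ} {L : List ℕ} (h : [a, b, c, d].Sublist L) : [a, b, c].Sublist L :=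
  List.Sublist.trans (by simp) h

theorem ne2 {L : List ℕ} {a b : ℕ} (hn : L.Nodup) (h : [a, b].Sublist L) : a ≠ b := by
  have := hn.sublist h
  simpa using this

theorem ne_cd {L : List ℕ} {a b c d : ℕ} (hn : L.Nodup) (h : [a, b, c, d].Sublist L) :
    a ≠ b ∧ c ≠ d := by
  have := hn.sublist h
  simp at this
  tauto

theorem hx_head {L R : List ℕ} {n h : ℕ} (hh : h ∈ L) : (h :: R).Sublist (L ++ n :: R) :=
  List.Sublist.append (List.singleton_sublist.2 hh) (List.sublist_cons_self n R)

theorem hx_two {L R : List ℕ} {n r a b : ℕ} (hh : [a, b].Sublist L) (hr : r ∈ R) :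
    [a, b, n, r].Sublist (L ++ n :: R) :=
  List.Sublist.append hh ((List.singleton_sublist.2 hr).cons_cons n)

theorem HX_A : HX LA LF := by
  intro L R n h hnd hh hmin hL hR
  have hne : ∀ x ∈ L, ∀ r ∈ R, x ≠ r := by
    intro x hx r hr e
    have := (List.nodup_append.1 hnd).2.2 x hx r (by simp [hr])
    exact this e
  have hnL : L.Nodup := (List.nodup_append.1 hnd).1
  constructor
  · intro H
    refine ⟨⟨?_, ?_⟩, ?_, ?_⟩
    · intro a b c hs hc
      have hm := mem3 hs
      have h4 : [a, b, c, n].Sublist (L ++ n :: R) :=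
        List.Sublist.append hs (List.singleton_sublist.2 (by simp : n ∈ n :: R))
      have := H a b c n h4 hc.2 (hL _ hm.1) (by omega) (hL _ hm.2.1)
      omega
    · intro a b c d hs hc
      have := H a b c d (hs.trans (List.sublist_append_left _ _))
      omega
    · intro a b c d hs
      exact H a b c d (hs.trans (hx_head hh))
    · intro x hx hxh r hr
      by_contra hc
      have h1 := hne x hx r hr
      have h2 := hmin x hx
      have h3 := hR r hr
      have h4 := hL x hx
      rcases sub_pair hx hh hxh with hs | hs
      · have := H _ _ _ _ (hx_two hs hr); omega
      · have := H _ _ _ _ (hx_two hs hr); omega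
  · rintro ⟨⟨F1, F2⟩, HA, HT⟩ a b c d hs ac ad bc bd
    have key : ∀ y ∈ R, [a, b].Sublist L → a < y → b < y → False := by
      intro y hy hs h1 h2
      have hm := mem2 hs
      have := ne2 hnL hs
      by_cases e : a = h
      · have := HT b hm.2 (by omega) y hy; omega
      · have := HT a hm.1 e y hy; omega
    have hnn := ne_cd hnd hs
    rcases split4 hs with h1 | ⟨h1, h2 | h2⟩ | ⟨h1, ⟨h2, h3⟩ | h2⟩ | ⟨h1, ⟨h2, h3⟩ | h2⟩ | ⟨h1, h2⟩ | h1
    · have := F1 a b c (pre3 h1)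
      have := F2 a b c d h1
      omega
    · have := F1 a b c h1
      have := hL c (mem3 h1).2.2
      omega
    · exact (key d h2 (pre2 h1) ad bd).elim
    · exact (key d h3 h1 ad bd).elim
    · exact (key d (mem2 h2).2 h1 ad bd).elim
    · have := hR c (mem2 h3).1; omega
    · by_cases e : a = h
      · subst e
        exact HA a b c d (h2.cons_cons a) ac ad bc bd
      · have := HT a h1 e c (mem3 h2).2.1; omega
    · have := hR c (mem3 h2).2.1; omega
    · exact HA a b c d (h1.cons h) ac ad bc bd

theorem HX_F : HX LF LI := by
  intro L R n h hnd hh hmin hL hR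
  have hne : ∀ x ∈ L, ∀ r ∈ R, x ≠ r := by
    intro x hx r hr e
    have := (List.nodup_append.1 hnd).2.2 x hx r (by simp [hr])
    exact this e
  have hnL : L.Nodup := (List.nodup_append.1 hnd).1
  constructor
  · rintro ⟨H1, H2⟩
    have hI : LI L := by
      intro a b hs
      have hm := mem2 hs
      have h4 : [a, b, n].Sublist (L ++ n :: R) :=
        List.Sublist.append hs (List.singleton_sublist.2 (by simp : n ∈ n :: R))
      have := H1 a b n h4
      have := ne2 hnL hs
      have := hL _ hm.1
      omega
    refine ⟨hI, ⟨?_, ?_⟩, ?_⟩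
    · intro a b c hs
      exact H1 a b c (hs.trans (hx_head hh))
    · intro a b c d hs
      exact H2 a b c d (hs.trans (hx_head hh))
    · intro x hx hxh r hr
      by_contra hc
      have h1 := hne x hx r hr
      have h2 := hmin x hx
      have h3 := hR r hr
      have h4 := hL x hx
      rcases sub_pair hx hh hxh with hs | hs
      · have := H2 _ _ _ _ (hx_two hs hr); omega
      · have := hI _ _ hs; omega
  · rintro ⟨HI, ⟨F1, F2⟩, HT⟩
    have key : ∀ a b, ∀ y ∈ R, [a, b].Sublist L → a < y → b < y → False := by
      intro a b y hy hs h1 h2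
      have hm := mem2 hs
      have := ne2 hnL hs
      by_cases e : a = h
      · have := HT b hm.2 (by omega) y hy; omega
      · have := HT a hm.1 e y hy; omega
    constructor
    · rintro a b c hs ⟨ba, ac⟩
      rcases split3 hs with h1 | ⟨h1, h2⟩ | ⟨h1, ⟨h2, h3⟩ | h2⟩ | ⟨h1, h2⟩ | h1
      · have := HI a b (pre2 h1); omega
      · have := HI a b h1; omega
      · have := hL a h1; omega
      · by_cases e : a = h
        · subst e
          exact F1 a b c (h2.cons_cons a) ⟨ba, ac⟩
        · have := HT a h1 e c (mem2 h2).2; omega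
      · have := hR c (mem2 h2).2; omega
      · exact F1 a b c (h1.cons h) ⟨ba, ac⟩
    · rintro a b c d hs ⟨ab, bd, dc⟩
      rcases split4 hs with h1 | ⟨h1, h2 | h2⟩ | ⟨h1, ⟨h2, h3⟩ | h2⟩ | ⟨h1, ⟨h2, h3⟩ | h2⟩ | ⟨h1, h2⟩ | h1
      · have : [c, d].Sublist [a, b, c, d] := by simp
        have := HI c d (this.trans h1)
        omega
      · have := hL c (mem3 h1).2.2
        omega
      · exact (key a b d h2 (pre2 h1) (by omega) bd).elim
      · exact (key a b d h3 h1 (by omega) bd).elim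
      · exact (key a b d (mem2 h2).2 h1 (by omega) bd).elim
      · have := hR d (mem2 h3).2; omega
      · by_cases e : a = h
        · subst e
          exact F2 a b c d (h2.cons_cons a) ⟨ab, bd, dc⟩
        · have := HT a h1 e d (mem3 h2).2.2; omega
      · have := hR d (mem3 h2).2.2; omega
      · exact F2 a b c d (h1.cons h) ⟨ab, bd, dc⟩

theorem HX0_A : HX0 LA := by
  intro R n hR
  constructor
  · intro H a b c d hs
    exact H a b c d (hs.cons n)
  · intro H a b c d hs ac ad bc bd
    rcases List.sublist_cons_iff.1 hs with h1 | ⟨r, h1, h2⟩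
    · exact H a b c d h1 ac ad bc bd
    · simp at h1
      obtain ⟨rfl, rfl⟩ := h1
      have := hR c (mem3 h2).2.1
      omega

theorem HX0_F : HX0 LF := by
  intro R n hR
  constructor
  · rintro ⟨H1, H2⟩
    exact ⟨fun a b c hs => H1 a b c (hs.cons n), fun a b c d hs => H2 a b c d (hs.cons n)⟩
  · rintro ⟨H1, H2⟩
    constructor
    · rintro a b c hs ⟨h3, h4⟩
      rcases List.sublist_cons_iff.1 hs with h1 | ⟨r, h1, h2⟩
      · exact H1 a b c h1 ⟨h3, h4⟩
      · simp at h1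
        obtain ⟨rfl, rfl⟩ := h1
        have := hR c (mem2 h2).2
        omega
    · rintro a b c d hs h3
      rcases List.sublist_cons_iff.1 hs with h1 | ⟨r, h1, h2⟩
      · exact H2 a b c d h1 h3
      · simp at h1
        obtain ⟨rfl, rfl⟩ := h1
        have := hR b (mem3 h2).1
        omega

theorem HInv_I : HInv LI := by
  intro L g hg
  constructor
  · intro H a b hs
    exact hg.lt_iff_lt.1 (H (g a) (g b) (hs.map g))
  · intro H a b hs
    obtain ⟨l', h1, h2⟩ := List.sublist_map_iff.1 hs
    rcases l' with _ | ⟨x, _ | ⟨y, _ | ⟨z, t⟩⟩⟩ <;> simp at h2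
    obtain ⟨rfl, rfl⟩ := h2
    exact hg (H x y h1)

theorem HInv_F : HInv LF := by
  intro L g hg
  constructor
  · rintro ⟨H1, H2⟩
    constructor
    · intro a b c hs
      have := H1 (g a) (g b) (g c) (hs.map g)
      simpa only [hg.lt_iff_lt] using this
    · intro a b c d hs
      have := H2 (g a) (g b) (g c) (g d) (hs.map g)
      simpa only [hg.lt_iff_lt] using this
  · rintro ⟨H1, H2⟩
    constructor
    · intro a b c hs
      obtain ⟨l', h1, h2⟩ := List.sublist_map_iff.1 hs
      rcases l' with _ | ⟨x, _ | ⟨y, _ | ⟨z, _ | ⟨u, t⟩⟩⟩⟩ <;> simp at h2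
      obtain ⟨rfl, rfl, rfl⟩ := h2
      simpa only [hg.lt_iff_lt] using H1 x y z h1
    · intro a b c d hs
      obtain ⟨l', h1, h2⟩ := List.sublist_map_iff.1 hs
      rcases l' with _ | ⟨x, _ | ⟨y, _ | ⟨z, _ | ⟨u, _ | ⟨v, t⟩⟩⟩⟩⟩ <;> simp at h2
      obtain ⟨rfl, rfl, rfl, rfl⟩ := h2
      simpa only [hg.lt_iff_lt] using H2 x y z u h1

def WS (X : List ℕ → Prop) (n : ℕ) : Set (List ℕ) := {l | l.Perm (List.range n) ∧ X l}

instance WS_finite (X : List ℕ → Prop) (n : ℕ) : Finite (WS X n) := by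
  apply Set.Finite.to_subtype
  apply (List.finite_toSet (List.range n).permutations).subset
  intro l hl
  exact List.mem_permutations.2 hl.1

def gmap (h k i : ℕ) : ℕ := if i = 0 then h else k + i - 1

theorem gmap_mono {h k : ℕ} (hk : h < k) : StrictMono (gmap h k) := by
  intro i j hij
  unfold gmap
  split_ifs <;> omega

theorem glue_perm {n m : ℕ} (hm : m < n) {L R : List ℕ} {h : ℕ}
    (hL : L.Perm (List.range (m + 1))) (hR : (h :: R).Perm (List.range (n - m))) :
    (L.map (gmap h (n - m)) ++ n :: R).Perm (List.range (n + 1)) := by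
  have h1 : (L.map (gmap h (n - m))).Perm (h :: (List.range m).map (fun i => (n - m) + i)) := by
    refine (hL.map _).trans ?_
    rw [List.range_succ_eq_map]
    simp [gmap, Function.comp_def]
  have h2 : List.range (n + 1) = (List.range (n - m) ++ (List.range m).map (fun i => (n - m) + i)) ++ [n] := by
    rw [← List.range_add, Nat.sub_add_cancel hm.le, List.range_succ]
  rw [h2]
  calc (L.map (gmap h (n - m)) ++ n :: R).Perm
        ((h :: (List.range m).map (fun i => (n - m) + i)) ++ n :: R) := h1.append_right _
    _ |>.Perm ((h :: R) ++ (List.range m).map (fun i => (n - m) + i) ++ [n]) := by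
        rw [List.perm_iff_count]
        intro a
        simp [List.count_cons]
        omega
    _ |>.Perm _ := (hR.append_right _).append_right _

theorem append_cons_inj' {α : Type*} {n : α} : ∀ {L L' R R' : List α}, n ∉ L → n ∉ L' →
    L ++ n :: R = L' ++ n :: R' → L = L' ∧ R = R'
  | [], [], _, _, _, _, h => by simpa using h
  | [], a :: L', _, _, _, h2, h => by
      simp at h h2
      exact absurd h.1 h2.1
  | a :: L, [], _, _, h1, _, h => by
      simp at h h1
      exact absurd h.1.symm h1.1
  | a :: L, b :: L', R, R', h1, h2, h => by
      simp at h h1 h2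
      have := append_cons_inj' h1.2 h2.2 h.2
      simp [h.1, this.1, this.2]

theorem perm_range_of_lower {T : List ℕ} (hn : T.Nodup) (hl : ∀ x ∈ T, ∀ y < x, y ∈ T) :
    T.Perm (List.range T.length) := by
  apply List.Subperm.perm_of_length_le
  · apply List.subperm_of_subset hn
    intro x hx
    have : Finset.range (x + 1) ⊆ T.toFinset := by
      intro y hy
      simp at hy
      rcases lt_or_eq_of_le hy with h | h
      · simpa using hl x hx y h
      · subst h; simpa using hx
    have := Finset.card_le_card this
    rw [List.toFinset_card_of_nodup hn] at this
    simp at this ⊢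
    omega
  · simp

def glueFun (X P : List ℕ → Prop) (n : ℕ) :
    (WS X n ⊕ (Σ m : Fin n, WS P (m + 1) × WS X (n - m))) → List ℕ
  | Sum.inl l => n :: l.1
  | Sum.inr ⟨m, L, ρ⟩ => L.1.map (gmap ρ.1.headI (n - m)) ++ n :: ρ.1.tail

theorem cons_of_WS {X : List ℕ → Prop} {n : ℕ} {m : Fin n} (ρ : WS X (n - m)) :
    ∃ h R, ρ.1 = h :: R ∧ h < n - m ∧ (∀ x ∈ R, x < n - m) ∧ (h :: R).Nodup := by
  obtain ⟨ρ, hρ, hx⟩ := ρ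
  have hlen := hρ.length_eq
  simp at hlen
  have hm := m.2
  rcases ρ with _ | ⟨h, R⟩
  · simp at hlen; omega
  · refine ⟨h, R, rfl, ?_, ?_, ?_⟩
    · simpa using hρ.subset (by simp : h ∈ h :: R)
    · intro x hx
      simpa using hρ.subset (by simp [hx] : x ∈ h :: R)
    · exact hρ.nodup_iff.2 List.nodup_range

theorem gmap_lt {n m h : ℕ} (hm : m < n) {L : List ℕ} (hL : L.Perm (List.range (m + 1)))
    (hh : h < n - m) : ∀ x ∈ L.map (gmap h (n - m)), x < n := by
  intro x hx
  obtain ⟨y, hy, rfl⟩ := List.mem_map.1 hx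
  have := hL.subset hy
  simp at this
  unfold gmap
  split_ifs <;> omega

theorem gmap_min {k h : ℕ} {L : List ℕ} 
    (hh : h < k) : ∀ x ∈ L.map (gmap h k), h ≤ x := by
  intro x hx
  obtain ⟨y, hy, rfl⟩ := List.mem_map.1 hx
  unfold gmap
  split_ifs <;> omega

theorem mem_gmap {k h m : ℕ} {L : List ℕ} (hL : L.Perm (List.range (m + 1))) :
    h ∈ L.map (gmap h k) := 
  List.mem_map.2 ⟨0, hL.symm.subset (by simp), by simp [gmap]⟩

theorem glue_mem {X P : List ℕ → Prop} (hX : HX X P) (h0 : HX0 X) (hP : HInv P) (n : ℕ)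
    (z : WS X n ⊕ (Σ m : Fin n, WS P (m + 1) × WS X (n - m))) :
    glueFun X P n z ∈ WS X (n + 1) := by
  rcases z with ⟨l, hl, hx⟩ | ⟨m, L, ρ⟩
  · constructor
    · simp only [glueFun]
      rw [List.range_succ]
      exact (List.Perm.cons n hl).trans (List.perm_append_singleton _ _).symm
    · simp only [glueFun]
      refine (h0 l n ?_).2 hx
      intro x hx
      simpa using hl.subset hx
  · obtain ⟨h, R, e, hh, hR, hnd⟩ := cons_of_WS ρ
    have hp := glue_perm m.2 L.2.1 (e ▸ ρ.2.1)
    simp only [glueFun, e, List.headI, List.tail]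
    refine ⟨hp, ?_⟩
    refine (hX _ R n h (hp.nodup_iff.2 List.nodup_range) (mem_gmap L.2.1) (gmap_min hh)
      (gmap_lt m.2 L.2.1 hh) (fun x hx => by have := hR x hx; omega)).2 ⟨?_, ?_, ?_⟩
    · exact (hP _ _ (gmap_mono hh)).2 L.2.2
    · exact e ▸ ρ.2.2
    · intro x hx hne r hr
      obtain ⟨y, hy, rfl⟩ := List.mem_map.1 hx
      have := hR r hr
      unfold gmap at hne ⊢
      split_ifs at hne ⊢ <;> omega

theorem glue_inj (X P : List ℕ → Prop) (n : ℕ) : Function.Injective (glueFun X P n) := by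
  intro z w hzw
  rcases z with l | ⟨m, L, ρ⟩ <;> rcases w with l' | ⟨m', L', ρ'⟩
  · simp only [glueFun, List.cons.injEq, true_and] at hzw
    rw [Subtype.ext hzw]
  · exfalso
    obtain ⟨h, R, e, hh, hR, hnd⟩ := cons_of_WS ρ'
    simp only [glueFun, e, List.headI, List.tail] at hzw
    have hn : n ∉ L'.1.map (gmap h (n - m')) :=
      fun hc => lt_irrefl _ (gmap_lt m'.2 L'.2.1 hh _ hc)
    have := (append_cons_inj' (L := []) (by simp) hn hzw).1
    have h3 := mem_gmap (h := h) (k := n - m') L'.2.1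
    rw [← this] at h3
    simp at h3
  · exfalso
    obtain ⟨h, R, e, hh, hR, hnd⟩ := cons_of_WS ρ
    simp only [glueFun, e, List.headI, List.tail] at hzw
    have hn : n ∉ L.1.map (gmap h (n - m)) :=
      fun hc => lt_irrefl _ (gmap_lt m.2 L.2.1 hh _ hc)
    have := (append_cons_inj' (L := []) (by simp) hn hzw.symm).1
    have h3 := mem_gmap (h := h) (k := n - m) L.2.1
    rw [← this] at h3
    simp at h3
  · obtain ⟨h, R, e, hh, hR, hnd⟩ := cons_of_WS ρ
    obtain ⟨h', R', e', hh', hR', hnd'⟩ := cons_of_WS ρ'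
    simp only [glueFun, e, e', List.headI, List.tail] at hzw
    have hn : n ∉ L.1.map (gmap h (n - m)) :=
      fun hc => lt_irrefl _ (gmap_lt m.2 L.2.1 hh _ hc)
    have hn' : n ∉ L'.1.map (gmap h' (n - m')) :=
      fun hc => lt_irrefl _ (gmap_lt m'.2 L'.2.1 hh' _ hc)
    obtain ⟨h1, rfl⟩ := append_cons_inj' hn hn' hzw
    have hl := congrArg List.length h1
    have hl1 := L.2.1.length_eq
    have hl2 := L'.2.1.length_eq
    simp at hl hl1 hl2
    have hmm : m = m' := Fin.ext (by omega)
    subst hmm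
    have hhh : h = h' := by
      apply le_antisymm
      · apply gmap_min hh
        rw [h1]
        exact mem_gmap L'.2.1
      · apply gmap_min hh'
        rw [← h1]
        exact mem_gmap L.2.1
    subst hhh
    have h4 := List.map_injective_iff.2 (gmap_mono hh).injective h1
    have h5 : L = L' := Subtype.ext h4
    have h6 : ρ = ρ' := Subtype.ext (e.trans e'.symm)
    rw [h5, h6]

theorem glue_surj {X P : List ℕ → Prop} (hX : HX X P) (h0 : HX0 X) (hP : HInv P) (n : ℕ)
    (l : List ℕ) (hl : l ∈ WS X (n + 1)) : ∃ z, glueFun X P n z = l := by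
  obtain ⟨hp, hx⟩ := hl
  have hnl : n ∈ l := hp.symm.subset (by simp)
  have hnd : l.Nodup := hp.nodup_iff.2 List.nodup_range
  obtain ⟨L, R, rfl⟩ := List.append_of_mem hnl
  have hlt : ∀ x ∈ L ++ n :: R, x ≠ n → x < n := by
    intro x hx hne
    have := hp.subset hx
    simp at this
    omega
  have hnd' := hnd
  rw [List.nodup_append] at hnd'
  obtain ⟨hnL, hnR, hdis⟩ := hnd'
  have hR : ∀ x ∈ R, x < n := fun x hxR => hlt x (by simp [hxR]) (by
    rintro rfl
    exact (List.nodup_cons.1 hnR).1 hxR)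
  have hL : ∀ x ∈ L, x < n := fun x hx => hlt x (by simp [hx]) (hdis x hx n (by simp))
  rcases eq_or_ne L [] with rfl | hne
  · refine ⟨Sum.inl ⟨R, ?_, (h0 R n hR).1 hx⟩, rfl⟩
    rw [List.range_succ] at hp
    exact List.Perm.cons_inv (hp.trans (List.perm_append_singleton _ _))
  · obtain ⟨h, hh, hmin⟩ : ∃ h ∈ L, ∀ x ∈ L, h ≤ x := by
      obtain ⟨h, hh, hm⟩ := L.toFinset.exists_min_image id (by simpa using hne)
      exact ⟨h, by simpa using hh, fun x hx => hm x (by simpa using hx)⟩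
    obtain ⟨hPL, hXR, hT⟩ := (hX L R n h hnd hh hmin hL hR).1 hx
    have hlen := hp.length_eq
    simp at hlen
    have hLpos := List.length_pos_of_mem hh
    have hhR : h ∉ R := fun hc => hdis h hh h (by simp [hc]) rfl
    have hnT : (h :: R).Nodup := List.nodup_cons.2 ⟨hhR, (List.nodup_cons.1 hnR).2⟩
    have hTp : (h :: R).Perm (List.range (h :: R).length) := by
      apply perm_range_of_lower hnT
      intro x hx y hy
      have hxn : x < n := by
        rcases List.mem_cons.1 hx with rfl | hx
        · exact hL x hh
        · exact hR x hx
      have hyl : y ∈ L ++ n :: R := hp.symm.subset (by simp; omega)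
      simp at hyl
      rcases hyl with hy' | hy' | hy'
      · by_cases e : y = h
        · simp [e]
        · rcases List.mem_cons.1 hx with rfl | hx
          · have := hmin y hy'; omega
          · have := hT y hy' e x hx; omega
      · omega
      · simp [hy']
    obtain ⟨m, hm⟩ : ∃ m, L.length = m + 1 := ⟨L.length - 1, by omega⟩
    have hmn : m < n := by omega
    have hk : (h :: R).length = n - m := by simp; omega
    rw [hk] at hTp
    have hhk : h < n - m := by simpa using hTp.subset (by simp : h ∈ h :: R)
    have hge : ∀ x ∈ L, x ≠ h → n - m ≤ x := by
      intro x hx hxh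
      by_contra hc
      have : x ∈ h :: R := hTp.symm.subset (List.mem_range.2 (by omega))
      rcases List.mem_cons.1 this with e | e
      · exact hxh e
      · exact hdis x hx x (by simp [e]) rfl
    set L' := L.map (fun x => if x = h then 0 else x + 1 - (n - m)) with hL'
    have hmap : L'.map (gmap h (n - m)) = L := by
      rw [hL', List.map_map]
      conv_rhs => rw [← List.map_id L]
      apply List.map_congr_left
      intro x hx
      have := hge x hx
      simp only [Function.comp, gmap, id]
      split_ifs <;> omega
    have hLp : L'.Perm (List.range (m + 1)) := by
      apply List.Subperm.perm_of_length_le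
      · apply List.subperm_of_subset
        · apply List.Nodup.of_map (gmap h (n - m))
          rw [hmap]; exact hnL
        · intro x hx
          obtain ⟨y, hy, rfl⟩ := List.mem_map.1 hx
          have := hL y hy
          simp only [List.mem_range]
          split_ifs <;> omega
      · simp [hL', hm]
    refine ⟨Sum.inr ⟨⟨m, hmn⟩, ⟨L', hLp, ?_⟩, ⟨h :: R, hTp, hXR⟩⟩, ?_⟩
    · rw [← hP _ _ (gmap_mono hhk), hmap]; exact hPL
    · simp only [glueFun, List.headI, List.tail, hmap]

theorem WS_rec {X P : List ℕ → Prop} (hX : HX X P) (h0 : HX0 X) (hP : HInv P) (n : ℕ) :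
    Nat.card (WS X (n + 1)) =
      Nat.card (WS X n) + ∑ m : Fin n, Nat.card (WS P (m + 1)) * Nat.card (WS X (n - m)) := by
  have : Function.Bijective (fun z => (⟨glueFun X P n z, glue_mem hX h0 hP n z⟩ : WS X (n + 1))) := by
    constructor
    · intro z w hzw
      exact glue_inj X P n (congrArg Subtype.val hzw)
    · rintro ⟨l, hl⟩
      obtain ⟨z, hz⟩ := glue_surj hX h0 hP n l hl
      exact ⟨z, Subtype.ext hz⟩
  rw [← Nat.card_congr (Equiv.ofBijective _ this), Nat.card_sum, Nat.card_sigma]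
  simp only [Nat.card_prod]

theorem WS_zero {X : List ℕ → Prop} (h : X []) : Nat.card (WS X 0) = 1 := by
  have : WS X 0 = {[]} := by
    ext l
    simp only [WS, List.range_zero, List.perm_nil, Set.mem_ofPred_eq, Set.mem_singleton_iff]
    constructor
    · exact fun h => h.1
    · rintro rfl; exact ⟨rfl, h⟩
  rw [this]; simp

theorem WS_I (n : ℕ) : Nat.card (WS LI n) = 1 := by
  have hp : ∀ l, LI l ↔ l.Pairwise (· < ·) := by
    intro l
    rw [List.pairwise_iff_forall_sublist]
    exact ⟨fun h a b => h a b, fun h a b => h⟩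
  have : WS LI n = {List.range n} := by
    ext l
    simp only [WS, Set.mem_ofPred_eq, Set.mem_singleton_iff, hp]
    constructor
    · rintro ⟨h1, h2⟩
      exact h1.eq_of_pairwise (fun a b _ _ h h' => by omega) h2 List.pairwise_lt_range
    · rintro rfl
      exact ⟨List.Perm.refl _, List.pairwise_lt_range⟩
  rw [this]; simp

inductive BW (Q : List Step → Prop) : List Step → Prop
  | nil : BW Q []
  | dcons {p : List Step} : BW Q p → BW Q (Step.D :: p)
  | block {q p : List Step} : Q q → BW Q p → BW Q (Step.N :: (q ++ Step.E :: p))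

def Bal (q : List Step) : Prop := IsSchroderPrefix q ∧ posX q = posY q

def QP (q : List Step) : Prop := ∃ k : ℕ, q = List.replicate k Step.N ++ List.replicate k Step.E

theorem posX_append (p q : List Step) : posX (p ++ q) = posX p + posX q := by
  simp [posX]; omega

theorem posY_append (p q : List Step) : posY (p ++ q) = posY p + posY q := by
  simp [posY]; omega

@[simp] theorem posX_nil : posX [] = 0 := rfl
@[simp] theorem posY_nil : posY [] = 0 := rfl
@[simp] theorem posX_N (p : List Step) : posX (Step.N :: p) = posX p := by simp [posX]
@[simp] theorem posX_E (p : List Step) : posX (Step.E :: p) = posX p + 1 := by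
  simp [posX]; omega
@[simp] theorem posX_D (p : List Step) : posX (Step.D :: p) = posX p + 1 := by
  simp [posX]; omega
@[simp] theorem posY_N (p : List Step) : posY (Step.N :: p) = posY p + 1 := by
  simp [posY]; omega
@[simp] theorem posY_E (p : List Step) : posY (Step.E :: p) = posY p := by simp [posY]
@[simp] theorem posY_D (p : List Step) : posY (Step.D :: p) = posY p + 1 := by
  simp [posY]; omega

theorem Bal_nil : Bal [] := by
  refine ⟨?_, rfl⟩
  intro q hq
  rw [List.prefix_nil.1 hq]; simp

theorem Bal_D {p : List Step} (h : Bal p) : Bal (Step.D :: p) := by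
  refine ⟨?_, by simp [h.2]⟩
  intro q hq
  rcases q with _ | ⟨s, q⟩
  · simp
  · obtain ⟨rfl, h2⟩ := List.cons_prefix_cons.1 hq
    have := h.1 q h2
    simp; exact this

theorem Bal_block {q p : List Step} (hq : Bal q) (h : Bal p) :
    Bal (Step.N :: (q ++ Step.E :: p)) := by
  refine ⟨?_, by simp [posX_append, posY_append, h.2, hq.2]; omega⟩
  intro r hr
  rcases r with _ | ⟨s, r⟩
  · simp
  · obtain ⟨rfl, h2⟩ := List.cons_prefix_cons.1 hr
    simp
    rcases List.prefix_or_prefix_of_prefix h2 (List.prefix_append q _) with h3 | ⟨t, rfl⟩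
    · have := hq.1 r h3; omega
    · have h3 := (List.prefix_append_right_inj q).1 h2
      rcases t with _ | ⟨s, t⟩
      · simp; have := hq.2; omega
      · obtain ⟨rfl, h4⟩ := List.cons_prefix_cons.1 h3
        have := h.1 t h4
        have := hq.2
        simp [posX_append, posY_append]; omega

theorem Bal_BW {Q : List Step → Prop} (hQ : ∀ q, Q q → Bal q) {p : List Step} (h : BW Q p) :
    Bal p := by
  induction h with
  | nil => exact Bal_nil
  | dcons _ ih => exact Bal_D ih
  | block h1 _ ih => exact Bal_block (hQ _ h1) ih

theorem QP_succ (k : ℕ) : List.replicate (k + 1) Step.N ++ List.replicate (k + 1) Step.E =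
    Step.N :: ((List.replicate k Step.N ++ List.replicate k Step.E) ++ Step.E :: []) := by
  rw [List.replicate_succ, List.replicate_succ' (a := Step.E)]; simp

theorem Bal_QP {q : List Step} (h : QP q) : Bal q := by
  obtain ⟨k, rfl⟩ := h
  induction k with
  | zero => exact Bal_nil
  | succ k ih =>
    rw [QP_succ]
    exact Bal_block ih Bal_nil

theorem inner_iff (p : List Step) : IsInnerWord p ↔ BW QP p := by
  constructor
  · intro h
    induction h with
    | nil => exact BW.nil
    | dcons _ ih => exact BW.dcons ih
    | @peak k p hk _ ih =>
      obtain ⟨k, rfl⟩ : ∃ j, k = j + 1 := ⟨k - 1, by omega⟩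
      rw [QP_succ]
      have := BW.block (Q := QP) ⟨k, rfl⟩ ih
      simpa using this
  · intro h
    induction h with
    | nil => exact IsInnerWord.nil
    | dcons _ ih => exact IsInnerWord.dcons ih
    | @block q p hq _ ih =>
      obtain ⟨k, rfl⟩ := hq
      have := IsInnerWord.peak (k := k + 1) (by omega) ih
      rw [QP_succ] at this
      simpa using this

theorem dword_iff (p : List Step) : IsDWord p ↔ BW (BW QP) p := by
  constructor
  · intro h
    induction h with
    | nil => exact BW.nil
    | dcons _ ih => exact BW.dcons ih
    | block h1 _ ih => exact BW.block ((inner_iff _).1 h1) ih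
  · intro h
    induction h with
    | nil => exact IsDWord.nil
    | dcons _ ih => exact IsDWord.dcons ih
    | block h1 _ ih => exact IsDWord.block ((inner_iff _).2 h1) ih

theorem bal_split_aux {q q' p p' : List Step} (hq : Bal q) (hq' : Bal q')
    (h : q ++ Step.E :: p = q' ++ Step.E :: p') (hp : q <+: q') : q = q' := by
  obtain ⟨t, rfl⟩ := hp
  rcases t with _ | ⟨s, t⟩
  · simp
  · exfalso
    simp at h
    obtain ⟨rfl, _⟩ := h
    have := hq'.1 (q ++ [Step.E]) ⟨t, by simp⟩
    have h2 := hq.2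
    simp [posX_append, posY_append] at this
    omega

theorem bal_split {q q' p p' : List Step} (hq : Bal q) (hq' : Bal q')
    (h : q ++ Step.E :: p = q' ++ Step.E :: p') : q = q' ∧ p = p' := by
  have : q = q' := by
    rcases List.prefix_or_prefix_of_prefix (List.prefix_append q (Step.E :: p))
      (h ▸ List.prefix_append q' (Step.E :: p')) with h1 | h1
    · exact bal_split_aux hq hq' h h1
    · exact (bal_split_aux hq' hq h.symm h1).symm
  subst this
  simpa using h

def CS (Q : List Step → Prop) (n : ℕ) : Set (List Step) := {p | Q p ∧ posX p = n}

theorem CS_finite {Q : List Step → Prop} (hQ : ∀ q, Q q → Bal q) (n : ℕ) : Finite (CS Q n) := by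
  have : Finite Step := Finite.of_surjective
    (fun i : Fin 3 => match i with | 0 => Step.E | 1 => Step.N | 2 => Step.D) (by
      intro s
      cases s
      · exact ⟨0, rfl⟩
      · exact ⟨1, rfl⟩
      · exact ⟨2, rfl⟩)
  apply Set.Finite.to_subtype
  apply (List.finite_length_le Step (n + n)).subset
  rintro p ⟨h1, h2⟩
  have h3 := (hQ p h1).2
  have h4 : ∀ p : List Step, p.length ≤ posX p + posY p := by
    intro p
    induction p with
    | nil => simp
    | cons s p ih => cases s <;> simp <;> omega
  have := h4 p
  simp only [Set.mem_ofPred_eq]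
  omega

def pathFun (Q : List Step → Prop) (n : ℕ) :
    (CS (BW Q) n ⊕ (Σ m : Fin (n + 1), CS Q m × CS (BW Q) (n - m))) → List Step
  | Sum.inl p => Step.D :: p.1
  | Sum.inr ⟨_, q, p⟩ => Step.N :: (q.1 ++ Step.E :: p.1)

theorem CS_rec {Q : List Step → Prop} (hQ : ∀ q, Q q → Bal q) (n : ℕ) :
    Nat.card (CS (BW Q) (n + 1)) = Nat.card (CS (BW Q) n) +
      ∑ m : Fin (n + 1), Nat.card (CS Q m) * Nat.card (CS (BW Q) (n - m)) := by
  have hmem : ∀ z, pathFun Q n z ∈ CS (BW Q) (n + 1) := by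
    rintro (⟨p, h1, h2⟩ | ⟨m, ⟨q, h1, h2⟩, ⟨p, h3, h4⟩⟩)
    · exact ⟨BW.dcons h1, by simp [pathFun, h2]⟩
    · refine ⟨BW.block h1 h3, ?_⟩
      have := m.2
      simp [pathFun, posX_append, h2, h4]
      omega
  have hbij : Function.Bijective (fun z => (⟨pathFun Q n z, hmem z⟩ : CS (BW Q) (n + 1))) := by
    constructor
    · intro z w hzw
      have hzw := congrArg Subtype.val hzw
      rcases z with p | ⟨m, q, p⟩ <;> rcases w with p' | ⟨m', q', p'⟩
      · simp [pathFun] at hzw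
        rw [Subtype.ext hzw]
      · simp [pathFun] at hzw
      · simp [pathFun] at hzw
      · simp [pathFun] at hzw
        obtain ⟨h1, h2⟩ := bal_split (hQ _ q.2.1) (hQ _ q'.2.1) hzw
        have hm : m = m' := Fin.ext (by rw [← q.2.2, ← q'.2.2, h1])
        subst hm
        rw [Subtype.ext h1, Subtype.ext h2]
    · rintro ⟨l, hl, hn⟩
      cases hl with
      | nil => simp at hn
      | @dcons p hp => exact ⟨Sum.inl ⟨p, hp, by simpa using hn⟩, rfl⟩
      | @block q p hq hp =>
        simp [posX_append] at hn
        exact ⟨Sum.inr ⟨⟨posX q, by omega⟩, ⟨q, hq, rfl⟩, ⟨p, hp, by simp; omega⟩⟩, rfl⟩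
  have := fun n => CS_finite hQ n
  have := fun n => CS_finite (Q := BW Q) (fun q h => Bal_BW hQ h) n
  rw [← Nat.card_congr (Equiv.ofBijective _ hbij), Nat.card_sum, Nat.card_sigma]
  simp only [Nat.card_prod]

theorem CS_zero {Q : List Step → Prop} : Nat.card (CS (BW Q) 0) = 1 := by
  have : CS (BW Q) 0 = {[]} := by
    ext l
    simp only [CS, Set.mem_ofPred_eq, Set.mem_singleton_iff]
    constructor
    · rintro ⟨h, h2⟩
      cases h with
      | nil => rfl
      | dcons => simp at h2
      | block => simp [posX_append] at h2
    · rintro rfl; exact ⟨BW.nil, rfl⟩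
  rw [this]; simp

theorem CS_QP (n : ℕ) : Nat.card (CS QP n) = 1 := by
  have hx : ∀ k, posX (List.replicate k Step.N ++ List.replicate k Step.E) = k := by
    intro k
    simp [posX, List.count_replicate]
  have : CS QP n = {List.replicate n Step.N ++ List.replicate n Step.E} := by
    ext l
    simp only [CS, Set.mem_ofPred_eq, Set.mem_singleton_iff]
    constructor
    · rintro ⟨⟨k, rfl⟩, h⟩
      rw [hx] at h
      rw [h]
    · rintro rfl
      exact ⟨⟨n, rfl⟩, hx n⟩
  rw [this]; simp

theorem link {X P : List ℕ → Prop} {Q : List Step → Prop} (hX : HX X P) (h0 : HX0 X)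
    (hP : HInv P) (hXn : X []) (hQ : ∀ q, Q q → Bal q)
    (H : ∀ m, Nat.card (WS P (m + 1)) = Nat.card (CS Q m)) (n : ℕ) :
    Nat.card (WS X (n + 1)) = Nat.card (CS (BW Q) n) := by
  induction n using Nat.strong_induction_on with
  | _ n ih =>
    rw [WS_rec hX h0 hP]
    rcases n with _ | n
    · rw [WS_zero hXn, CS_zero]; simp
    · rw [CS_rec hQ, ih n (by omega)]
      congr 1
      apply Finset.sum_congr rfl
      intro m _
      have hm := m.2
      have e : n + 1 - (m : ℕ) = (n - m) + 1 := by omega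
      rw [H, e, ih (n - m) (by omega)]

theorem main_count (n : ℕ) : Nat.card (WS LA (n + 1)) = Nat.card (CS (BW (BW QP)) n) := by
  refine link HX_A HX0_A HInv_F (by intro a b c d h; simp at h) (fun q h => Bal_BW (fun _ => Bal_QP) h) ?_ n
  intro m
  refine link HX_F HX0_F HInv_I ⟨by intro a b c h; simp at h, by intro a b c d h; simp at h⟩ (fun _ => Bal_QP) ?_ m
  intro m
  rw [WS_I, CS_QP]

def permList {n : ℕ} (π : Equiv.Perm (Fin n)) : List ℕ := List.ofFn (fun i => (π i : ℕ))

theorem sub_iff {n : ℕ} (π : Equiv.Perm (Fin n)) (a b c d : ℕ) :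
    [a, b, c, d].Sublist (permList π) ↔ ∃ i j k l : Fin n, i < j ∧ j < k ∧ k < l ∧
      a = π i ∧ b = π j ∧ c = π k ∧ d = π l := by
  have h1 : permList π = (List.finRange n).map (fun i => (π i : ℕ)) := by
    simp [permList, List.ofFn_eq_map]
  rw [h1]
  constructor
  · intro h
    obtain ⟨t, h2, h3⟩ := List.sublist_map_iff.1 h
    rcases t with _ | ⟨x, _ | ⟨y, _ | ⟨z, _ | ⟨u, _ | ⟨v, t⟩⟩⟩⟩⟩ <;> simp at h3
    obtain ⟨rfl, rfl, rfl, rfl⟩ := h3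
    have h4 : ([x, y, z, u] : List (Fin n)).Pairwise (· < ·) :=
      (List.pairwise_lt_finRange n).sublist h2
    simp at h4
    exact ⟨x, y, z, u, by tauto, by tauto, by tauto, rfl, rfl, rfl, rfl⟩
  · rintro ⟨i, j, k, l, hij, hjk, hkl, rfl, rfl, rfl, rfl⟩
    have : ([i, j, k, l] : List (Fin n)).Sublist (List.finRange n) := by
      have hp : ([i, j, k, l] : List (Fin n)).Pairwise (· < ·) := by
        simp; omega
      exact List.sublist_of_subperm_of_pairwise (r := (· < ·))
        (List.subperm_of_subset (hp.imp (fun h => h.ne)) (fun x _ => List.mem_finRange x)) hp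
        (List.pairwise_lt_finRange n)
    exact this.map (fun i => (π i : ℕ))

theorem contains_iff {n : ℕ} (π : Equiv.Perm (Fin n)) (τ : Equiv.Perm (Fin 4)) :
    Contains π τ ↔ ∃ i j k l : Fin n, i < j ∧ j < k ∧ k < l ∧
      ∀ a b : Fin 4, τ a < τ b ↔ π (![i, j, k, l] a) < π (![i, j, k, l] b) := by
  constructor
  · rintro ⟨f, hf, h⟩
    refine ⟨f 0, f 1, f 2, f 3, hf (by decide), hf (by decide), hf (by decide), ?_⟩
    have : ![f 0, f 1, f 2, f 3] = f := by
      funext i; fin_cases i <;> rfl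
    rw [this]; exact h
  · rintro ⟨i, j, k, l, h1, h2, h3, h⟩
    refine ⟨![i, j, k, l], ?_, h⟩
    rw [Fin.strictMono_iff_lt_succ]
    intro x
    fin_cases x <;> simpa

theorem contains_1243 {n : ℕ} (π : Equiv.Perm (Fin n)) :
    Contains π pat1243 ↔ ∃ i j k l : Fin n, i < j ∧ j < k ∧ k < l ∧
      π i < π j ∧ π j < π l ∧ π l < π k := by
  rw [contains_iff]
  refine exists_congr fun i => exists_congr fun j => exists_congr fun k => exists_congr fun l =>
    and_congr_right fun _ => and_congr_right fun _ => and_congr_right fun _ => ?_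
  constructor
  · intro h
    exact ⟨(h 0 1).1 (by decide), (h 1 3).1 (by decide), (h 3 2).1 (by decide)⟩
  · rintro ⟨h1, h2, h3⟩ a b
    have e : ∀ a b : Fin 4, pat1243 a < pat1243 b ↔ ![0, 1, 3, 2] a < (![0, 1, 3, 2] b : ℕ) := by decide
    rw [e]
    fin_cases a <;> fin_cases b <;> simp <;> omega

theorem contains_2143 {n : ℕ} (π : Equiv.Perm (Fin n)) :
    Contains π pat2143 ↔ ∃ i j k l : Fin n, i < j ∧ j < k ∧ k < l ∧
      π j < π i ∧ π i < π l ∧ π l < π k := by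
  rw [contains_iff]
  refine exists_congr fun i => exists_congr fun j => exists_congr fun k => exists_congr fun l =>
    and_congr_right fun _ => and_congr_right fun _ => and_congr_right fun _ => ?_
  constructor
  · intro h
    exact ⟨(h 1 0).1 (by decide), (h 0 3).1 (by decide), (h 3 2).1 (by decide)⟩
  · rintro ⟨h1, h2, h3⟩ a b
    have e : ∀ a b : Fin 4, pat2143 a < pat2143 b ↔ ![1, 0, 3, 2] a < (![1, 0, 3, 2] b : ℕ) := by decide
    rw [e]
    fin_cases a <;> fin_cases b <;> simp <;> omega

theorem rc_apply {n : ℕ} (π : Equiv.Perm (Fin n)) (i : Fin n) : rc π i = (π i.rev).rev := rfl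

theorem cond_iff {n : ℕ} (π : Equiv.Perm (Fin n)) :
    ((Avoids π pat1243 ∧ Avoids π pat2143) ∧
      (Avoids (rc π) pat1243 ∧ Avoids (rc π) pat2143)) ↔ LA (permList π) := by
  unfold Avoids
  rw [contains_1243, contains_2143, contains_1243, contains_2143]
  simp only [rc_apply, Fin.rev_lt_rev]
  constructor
  · rintro ⟨⟨h1, h2⟩, h3, -⟩ a b c d hs ac ad bc bd
    obtain ⟨i, j, k, l, hij, hjk, hkl, rfl, rfl, rfl, rfl⟩ := (sub_iff π _ _ _ _).1 hs
    have n1 : (π i : ℕ) ≠ π j := fun e => hij.ne (π.injective (Fin.ext e))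
    have n2 : (π k : ℕ) ≠ π l := fun e => hkl.ne (π.injective (Fin.ext e))
    simp only [← Fin.lt_def] at *
    by_contra hc
    rcases lt_or_ge (π i) (π j) with h | h
    · exact h1 ⟨i, j, k, l, hij, hjk, hkl, h, bd, by omega⟩
    · rcases lt_or_ge (π k) (π l) with h' | h'
      · exact h3 ⟨l.rev, k.rev, j.rev, i.rev, by simpa, by simpa, by simpa, by simpa, by simpa, by simp; omega⟩
      · exact h2 ⟨i, j, k, l, hij, hjk, hkl, by omega, ad, by omega⟩
  · intro H
    refine ⟨⟨?_, ?_⟩, ?_, ?_⟩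
    · rintro ⟨i, j, k, l, hij, hjk, hkl, h1, h2, h3⟩
      have := H _ _ _ _ ((sub_iff π _ _ _ _).2 ⟨i, j, k, l, hij, hjk, hkl, rfl, rfl, rfl, rfl⟩)
      omega
    · rintro ⟨i, j, k, l, hij, hjk, hkl, h1, h2, h3⟩
      have := H _ _ _ _ ((sub_iff π _ _ _ _).2 ⟨i, j, k, l, hij, hjk, hkl, rfl, rfl, rfl, rfl⟩)
      omega
    · rintro ⟨i, j, k, l, hij, hjk, hkl, h1, h2, h3⟩
      have := H _ _ _ _ ((sub_iff π _ _ _ _).2 ⟨l.rev, k.rev, j.rev, i.rev, by simpa, by simpa, by simpa, rfl, rfl, rfl, rfl⟩)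
      omega
    · rintro ⟨i, j, k, l, hij, hjk, hkl, h1, h2, h3⟩
      have := H _ _ _ _ ((sub_iff π _ _ _ _).2 ⟨l.rev, k.rev, j.rev, i.rev, by simpa, by simpa, by simpa, rfl, rfl, rfl, rfl⟩)
      omega

theorem permList_perm {n : ℕ} (π : Equiv.Perm (Fin n)) : (permList π).Perm (List.range n) := by
  apply List.Subperm.perm_of_length_le
  · apply List.subperm_of_subset
    · exact List.nodup_ofFn.2 (fun i j h => π.injective (Fin.ext h))
    · intro x hx
      simp only [permList, List.mem_ofFn] at hx
      obtain ⟨i, rfl⟩ := hx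
      simp
  · simp [permList]

theorem permList_inj {n : ℕ} : Function.Injective (permList (n := n)) := by
  intro π σ h
  have := List.ofFn_injective h
  ext i
  exact congrFun this i

theorem permList_surj {n : ℕ} (l : List ℕ) (h : l.Perm (List.range n)) :
    ∃ π : Equiv.Perm (Fin n), permList π = l := by
  have hlen : l.length = n := by simpa using h.length_eq
  subst hlen
  have hlt : ∀ i : Fin l.length, l.get i < l.length := fun i => by
    simpa using h.subset (List.get_mem l i)
  have hinj : Function.Injective (fun i : Fin l.length => (⟨l.get i, hlt i⟩ : Fin l.length)) := by
    intro i j hij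
    exact List.nodup_iff_injective_get.1 (h.nodup_iff.2 List.nodup_range) (congrArg Fin.val hij)
  refine ⟨Equiv.ofBijective _ (Finite.injective_iff_bijective.1 hinj), ?_⟩
  simp [permList]

theorem stmt_4 :
    ∀ n : ℕ,
      Set.ncard {π : Equiv.Perm (Fin (n + 1)) |
          (Avoids π pat1243 ∧ Avoids π pat2143) ∧
            (Avoids (rc π) pat1243 ∧ Avoids (rc π) pat2143)} =
        Set.ncard {p : List Step | MemD n p} := by
  intro n
  have h1 : Set.ncard {π : Equiv.Perm (Fin (n + 1)) |
          (Avoids π pat1243 ∧ Avoids π pat2143) ∧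
            (Avoids (rc π) pat1243 ∧ Avoids (rc π) pat2143)} = Set.ncard (WS LA (n + 1)) := by
    rw [← Set.ncard_image_of_injective _ permList_inj]
    congr 1
    ext l
    constructor
    · rintro ⟨π, hπ, rfl⟩
      exact ⟨permList_perm π, (cond_iff π).1 hπ⟩
    · rintro ⟨h1, h2⟩
      obtain ⟨π, rfl⟩ := permList_surj l h1
      exact ⟨π, (cond_iff π).2 h2, rfl⟩
  have h2 : {p : List Step | MemD n p} = CS (BW (BW QP)) n := by
    ext p
    simp only [MemD, CS, Set.mem_ofPred_eq, dword_iff, IsSchroderPath]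
    constructor
    · rintro ⟨h, _, h2, _⟩
      exact ⟨h, h2⟩
    · rintro ⟨h, h2⟩
      have := Bal_BW (fun q h => Bal_BW (fun _ => Bal_QP) h) h
      exact ⟨h, this.1, h2, this.2 ▸ h2⟩
  rw [h1, h2, ← Nat.card_coe_set_eq, ← Nat.card_coe_set_eq, main_count]
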